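/- Fix ω₀ ∈ ℝ³ with ω₀ ≠ 0 and α ∈ [0, 1). Let r_1, …, r_N, x_1, …, x_N : ℝ → ℝ³ be C¹ functions with ‖x_k(t)‖ = 1 for all t and all k, satisfying ṙ_k = x_k and ẋ_k = u_k^a × x_k with the control u_k^a = ω₀ + [ (r_k − r_av) × ω₀ − x_av + ( ⟨ω₀, x_av⟩/‖ω₀‖ − α ) ω₀/‖ω₀‖ ] × x_k, where r_av = (1/N) ∑_j r_j and x_av = (1/N) ∑_j x_j. Define v_k = x_k + r_k × ω₀, v_av = (1/N) ∑_j v_j, w_k = v_k − v_av + ( ⟨ω₀, x_av⟩/‖ω₀‖ − α ) ω₀/‖ω₀‖, and B(t) = (1/2) ∑_{k=1}^N ‖v_k − v_av‖² + (N/2)( ⟨ω₀, x_av⟩/‖ω₀‖ − α )². Then B'(t) = − ∑_{k=1}^N ‖w_k(t) × x_k(t)‖² ≤ 0 for all t. -/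

import Mathlib

noncomputable section

/-- Euclidean norm on `ℝ³` (represented as `Fin 3 → ℝ`). -/
def norm3 (v : Fin 3 → ℝ) : ℝ := Real.sqrt (∑ i, v i ^ 2)

/-- Euclidean inner product on `ℝ³`. -/
def inner3 (u v : Fin 3 → ℝ) : ℝ := ∑ i, u i * v i

/-- The cross product on `ℝ³`. -/
def cross3 (u v : Fin 3 → ℝ) : Fin 3 → ℝ := crossProduct u v

theorem norm3_sq (v : Fin 3 → ℝ) : norm3 v ^ 2 = inner3 v v := by
  rw [norm3, Real.sq_sqrt (Finset.sum_nonneg fun i _ => sq_nonneg (v i))]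
  simp only [inner3, sq]

theorem HasDerivAt.inner3 {f g : ℝ → Fin 3 → ℝ} {f' g' : Fin 3 → ℝ} {t : ℝ}
    (hf : HasDerivAt f f' t) (hg : HasDerivAt g g' t) :
    HasDerivAt (fun s => inner3 (f s) (g s)) (inner3 f' (g t) + inner3 (f t) g') t := by
  rw [hasDerivAt_pi] at hf hg
  simp only [_root_.inner3, ← Finset.sum_add_distrib]
  exact HasDerivAt.fun_sum fun i _ => (hf i).mul (hg i)

theorem HasDerivAt.cross3_const {f : ℝ → Fin 3 → ℝ} {f' : Fin 3 → ℝ} {t : ℝ}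
    (hf : HasDerivAt f f' t) (c : Fin 3 → ℝ) :
    HasDerivAt (fun s => cross3 (f s) c) (cross3 f' c) t :=
  (LinearMap.toContinuousLinearMap (crossProduct.flip c)).hasFDerivAt.comp_hasDerivAt t hf

theorem cross3_sum_smul {ι : Type*} (s : Finset ι) (a : ℝ) (f : ι → Fin 3 → ℝ)
    (c : Fin 3 → ℝ) : cross3 (a • ∑ j ∈ s, f j) c = a • ∑ j ∈ s, cross3 (f j) c := by
  simp [cross3]

theorem inner3_comm (u v : Fin 3 → ℝ) : inner3 u v = inner3 v u :=
  dotProduct_comm u v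

theorem inner3_sum_right {ι : Type*} (s : Finset ι) (u : Fin 3 → ℝ) (f : ι → Fin 3 → ℝ) :
    inner3 u (∑ j ∈ s, f j) = ∑ j ∈ s, inner3 u (f j) :=
  dotProduct_sum u s f

theorem inner3_add_right (u v w : Fin 3 → ℝ) :
    inner3 u (v + w) = inner3 u v + inner3 u w :=
  dotProduct_add u v w

theorem inner3_smul_right (a : ℝ) (u v : Fin 3 → ℝ) :
    inner3 u (a • v) = a * inner3 u v :=
  dotProduct_smul a u v

/-- Deviations from the mean are orthogonal, in the aggregate, to any fixed vector. -/
theorem sum_inner3_sub_mean {N : ℕ} (hN : (N : ℝ) ≠ 0) (f : Fin N → Fin 3 → ℝ)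
    (u : Fin 3 → ℝ) : ∑ k, inner3 u (f k - (N : ℝ)⁻¹ • ∑ j, f j) = 0 := by
  rw [← inner3_sum_right, Finset.sum_sub_distrib, Finset.sum_const, Finset.card_univ,
    Fintype.card_fin, ← Nat.cast_smul_eq_nsmul ℝ, smul_smul, mul_inv_cancel₀ hN, one_smul, sub_self]
  exact dotProduct_zero u

/-- The control torque `(w × x) × x` dissipates at rate `‖w × x‖²` along `w`. -/
theorem inner3_cross3_cross3_self (w x : Fin 3 → ℝ) :
    inner3 w (cross3 (cross3 w x) x) = -norm3 (cross3 w x) ^ 2 := by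
  rw [norm3_sq]
  simp only [inner3, cross3, cross_apply, Fin.sum_univ_three, Matrix.cons_val]
  ring

theorem inner3_cross3_self_left (u v : Fin 3 → ℝ) : inner3 u (cross3 u v) = 0 :=
  dot_self_cross u v

/-- For the pitch-regulating screw-formation control
`u_k^a = ω₀ + [(r_k − r_av) × ω₀ − x_av + (⟨ω₀, x_av⟩/‖ω₀‖ − α) ω₀/‖ω₀‖] × x_k`,
the composite Lyapunov function
`B = (1/2) ∑_k ‖v_k − v_av‖² + (N/2)(⟨ω₀, x_av⟩/‖ω₀‖ − α)²` satisfies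
`B' = − ∑_k ‖w_k × x_k‖² ≤ 0`, where
`w_k = v_k − v_av + (⟨ω₀, x_av⟩/‖ω₀‖ − α) ω₀/‖ω₀‖`. -/
theorem pitch_regulation_lyapunov
    (N : ℕ) (hN : 1 ≤ N) (ω₀ : Fin 3 → ℝ) (hω : ω₀ ≠ 0)
    (α : ℝ) (hα0 : 0 ≤ α) (hα1 : α < 1)
    (r x : Fin N → ℝ → Fin 3 → ℝ)
    (rav xav : ℝ → Fin 3 → ℝ)
    (hrav : ∀ t, rav t = (N : ℝ)⁻¹ • ∑ j, r j t)
    (hxav : ∀ t, xav t = (N : ℝ)⁻¹ • ∑ j, x j t)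
    (hunit : ∀ k t, norm3 (x k t) = 1)
    (hr : ∀ k t, HasDerivAt (r k) (x k t) t)
    (hx : ∀ k t, HasDerivAt (x k)
      (cross3 (ω₀ + cross3 (cross3 (r k t - rav t) ω₀ - xav t
        + (inner3 ω₀ (xav t) / norm3 ω₀ - α) • ((norm3 ω₀)⁻¹ • ω₀)) (x k t)) (x k t)) t)
    (v : Fin N → ℝ → Fin 3 → ℝ)
    (hv : ∀ k t, v k t = x k t + cross3 (r k t) ω₀)
    (vav : ℝ → Fin 3 → ℝ)
    (hvav : ∀ t, vav t = (N : ℝ)⁻¹ • ∑ j, v j t)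
    (w : Fin N → ℝ → Fin 3 → ℝ)
    (hw : ∀ k t, w k t = v k t - vav t
      + (inner3 ω₀ (xav t) / norm3 ω₀ - α) • ((norm3 ω₀)⁻¹ • ω₀)) :
    ∀ t,
      HasDerivAt (fun s => (1 / 2 : ℝ) * ∑ k, norm3 (v k s - vav s) ^ 2
          + ((N : ℝ) / 2) * (inner3 ω₀ (xav s) / norm3 ω₀ - α) ^ 2)
        (-(∑ k, norm3 (cross3 (w k t) (x k t)) ^ 2)) t ∧
      -(∑ k, norm3 (cross3 (w k t) (x k t)) ^ 2) ≤ 0 := by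
  intro t
  refine ⟨?_, neg_nonpos.mpr (Finset.sum_nonneg fun k _ => sq_nonneg _)⟩
  have hN0 : (N : ℝ) ≠ 0 := by positivity
  set c : ℝ := inner3 ω₀ (xav t) / norm3 ω₀ - α with hc
  set g : Fin N → Fin 3 → ℝ := fun k => cross3 (cross3 (w k t) (x k t)) (x k t) with hg
  have hvav_eq : vav t = xav t + cross3 (rav t) ω₀ := by
    rw [hvav, hxav, hrav, cross3_sum_smul, ← smul_add, ← Finset.sum_add_distrib]
    simp only [hv]
  have hx_deriv : ∀ k, HasDerivAt (x k) (cross3 ω₀ (x k t) + g k) t := by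
    intro k
    refine (hx k t).congr_deriv ?_
    simp only [hg, hw, hv, hvav_eq, ← hc, cross3, map_add, map_sub, LinearMap.add_apply,
      LinearMap.sub_apply, cross_self, map_zero, LinearMap.zero_apply]
    abel
  have hv_deriv : ∀ k, HasDerivAt (v k) (g k) t := by
    intro k
    rw [show v k = fun s => x k s + cross3 (r k s) ω₀ from funext (hv k)]
    refine ((hx_deriv k).fun_add ((hr k t).cross3_const ω₀)).congr_deriv ?_
    simp only [cross3, ← cross_anticomm ω₀ (x k t)]
    abel
  have hvav_deriv : HasDerivAt vav ((N : ℝ)⁻¹ • ∑ j, g j) t := by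
    rw [show vav = fun s => (N : ℝ)⁻¹ • ∑ j, v j s from funext hvav]
    exact (HasDerivAt.fun_sum fun j _ => hv_deriv j).fun_const_smul _
  have hxav_deriv : HasDerivAt xav ((N : ℝ)⁻¹ • ∑ j, (cross3 ω₀ (x j t) + g j)) t := by
    rw [show xav = fun s => (N : ℝ)⁻¹ • ∑ j, x j s from funext hxav]
    exact (HasDerivAt.fun_sum fun j _ => hx_deriv j).fun_const_smul _
  have hpitch : HasDerivAt (fun s => inner3 ω₀ (xav s) / norm3 ω₀ - α)
      ((N : ℝ)⁻¹ * (∑ j, inner3 ω₀ (g j)) / norm3 ω₀) t := by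
    refine (((hasDerivAt_const t ω₀).inner3 hxav_deriv).div_const _ |>.sub_const α).congr_deriv ?_
    have hzero : inner3 0 (xav t) = 0 := zero_dotProduct (xav t)
    simp only [hzero, inner3_smul_right, inner3_sum_right, inner3_add_right,
      inner3_cross3_self_left, zero_add]
  have hdev : ∀ k, HasDerivAt (fun s => norm3 (v k s - vav s) ^ 2)
      (2 * inner3 (v k t - vav t) (g k - (N : ℝ)⁻¹ • ∑ j, g j)) t := by
    intro k
    have hd := (hv_deriv k).fun_sub hvav_deriv
    simp only [norm3_sq]
    refine (hd.inner3 hd).congr_deriv ?_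
    rw [inner3_comm (g k - _), ← two_mul]
  have hmean : ∑ k, inner3 (v k t - vav t) ((N : ℝ)⁻¹ • ∑ j, g j) = 0 := by
    simp only [inner3_comm _ ((N : ℝ)⁻¹ • ∑ j, g j), hvav]
    exact sum_inner3_sub_mean hN0 (fun k => v k t) _
  refine (((HasDerivAt.fun_sum fun k (_ : k ∈ Finset.univ) => hdev k).const_mul
    (1 / 2 : ℝ)).fun_add ((hpitch.fun_pow 2).const_mul ((N : ℝ) / 2))).congr_deriv ?_
  have hsplit : ∀ k, -norm3 (cross3 (w k t) (x k t)) ^ 2 =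
      inner3 (v k t - vav t) (g k - (N : ℝ)⁻¹ • ∑ j, g j)
        + inner3 (v k t - vav t) ((N : ℝ)⁻¹ • ∑ j, g j)
        + c * (norm3 ω₀)⁻¹ * inner3 ω₀ (g k) := by
    intro k
    rw [← inner3_cross3_cross3_self, ← inner3_add_right, sub_add_cancel, mul_assoc,
      inner3_comm ω₀, ← inner3_smul_right, ← inner3_smul_right, inner3_comm _ (g k),
      inner3_comm (v k t - vav t), ← inner3_add_right, ← hw]
  rw [← Finset.sum_neg_distrib, Finset.sum_congr rfl fun k _ => hsplit k,
    Finset.sum_add_distrib, Finset.sum_add_distrib, hmean, ← Finset.mul_sum, ← Finset.mul_sum]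
  rw [← hc]
  field_simp
  ring
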